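/- Let m ≥ 2 and let Φ, Φ₁, …, Φ_m be Young functions. Suppose there exists M > 0 such that ‖∏_{i=1}^m fᵢ‖_{wL_Φ} ≤ M·∏_{i=1}^m ‖fᵢ‖_{wL_{Φᵢ}} for all fᵢ ∈ wL_{Φᵢ}(ℝⁿ), i = 1,…,m. Then ∏_{i=1}^m Φᵢ⁻¹(t) ≤ M·Φ⁻¹(t) for all t ≥ 0. -/

import Mathlib

open MeasureTheory ENNReal Filter

/-- A Young function: convex on `[0,∞)`, left-continuous, `Φ 0 = 0`,
nonnegative on `[0,∞)`, and `Φ t → ∞` as `t → ∞`. -/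
structure IsYoung (Φ : ℝ → ℝ) : Prop where
  nonneg : ∀ t, 0 ≤ t → 0 ≤ Φ t
  convexOn : ConvexOn ℝ (Set.Ici 0) Φ
  leftCont : ∀ t, 0 < t → ContinuousWithinAt Φ (Set.Iic t) t
  map_zero : Φ 0 = 0
  tendsto_top : Tendsto Φ atTop atTop

/-- Generalized inverse `Φ⁻¹(s) = inf {r ≥ 0 : Φ r > s}`. -/
noncomputable def youngInv (Φ : ℝ → ℝ) (s : ℝ) : ℝ :=
  sInf {r : ℝ | 0 ≤ r ∧ s < Φ r}

/-- The set `{b > 0 : ∫ Φ(|f|/b) dμ ≤ 1}` defining the Luxemburg norm. -/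
def orliczSet {α : Type*} [MeasurableSpace α] (μ : Measure α) (Φ : ℝ → ℝ)
    (f : α → ℝ) : Set ℝ :=
  {b : ℝ | 0 < b ∧ ∫⁻ x, ENNReal.ofReal (Φ (|f x| / b)) ∂μ ≤ 1}

/-- The Orlicz (Luxemburg) norm `‖f‖_{L_Φ} = inf {b > 0 : ∫ Φ(|f|/b) dμ ≤ 1}`
(equal to `∞` when no such `b` exists). -/
noncomputable def orliczNorm {α : Type*} [MeasurableSpace α] (μ : Measure α) (Φ : ℝ → ℝ)
    (f : α → ℝ) : ℝ≥0∞ :=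
  ⨅ b ∈ orliczSet μ Φ f, ENNReal.ofReal b

/-- `f ∈ L_Φ`: `f` is measurable and some `b > 0` satisfies `∫ Φ(|f|/b) dμ ≤ 1`. -/
def MemOrlicz {α : Type*} [MeasurableSpace α] (μ : Measure α) (Φ : ℝ → ℝ)
    (f : α → ℝ) : Prop :=
  Measurable f ∧ (orliczSet μ Φ f).Nonempty

/-- The set `{b > 0 : sup_{t>0} Φ(t)·μ{|f|/b > t} ≤ 1}` defining the weak Orlicz quasi-norm. -/
def wOrliczSet {α : Type*} [MeasurableSpace α] (μ : Measure α) (Φ : ℝ → ℝ)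
    (f : α → ℝ) : Set ℝ :=
  {b : ℝ | 0 < b ∧ ∀ t > 0, ENNReal.ofReal (Φ t) * μ {x | t < |f x| / b} ≤ 1}

/-- The weak Orlicz quasi-norm `‖f‖_{wL_Φ}` (equal to `∞` when no admissible `b` exists). -/
noncomputable def wOrliczNorm {α : Type*} [MeasurableSpace α] (μ : Measure α) (Φ : ℝ → ℝ)
    (f : α → ℝ) : ℝ≥0∞ :=
  ⨅ b ∈ wOrliczSet μ Φ f, ENNReal.ofReal b

/-- `f ∈ wL_Φ`: `f` is measurable and `‖f‖_{wL_Φ} < ∞`. -/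
def MemwOrlicz {α : Type*} [MeasurableSpace α] (μ : Measure α) (Φ : ℝ → ℝ)
    (f : α → ℝ) : Prop :=
  Measurable f ∧ wOrliczNorm μ Φ f < ⊤

theorem IsYoung.exists_lt {Φ : ℝ → ℝ} (hΦ : IsYoung Φ) (t : ℝ) : ∃ r, 0 ≤ r ∧ t < Φ r :=
  ((eventually_ge_atTop 0).and (hΦ.tendsto_top.eventually_gt_atTop t)).exists

theorem youngInv_nonneg (Φ : ℝ → ℝ) (t : ℝ) : 0 ≤ youngInv Φ t :=
  Real.sInf_nonneg fun _ hr => hr.1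

theorem apply_le_of_lt_youngInv {Φ : ℝ → ℝ} {s t : ℝ} (hs : 0 ≤ s) (hst : s < youngInv Φ t) :
    Φ s ≤ t := by
  by_contra! hlt
  exact hst.not_ge (csInf_le (s := {r | 0 ≤ r ∧ t < Φ r}) ⟨0, fun _ hr => hr.1⟩ ⟨hs, hlt⟩)

theorem IsYoung.le_youngInv {Φ : ℝ → ℝ} (hΦ : IsYoung Φ) {a t : ℝ} (ht : 0 ≤ t)
    (H : ∀ s, 0 < s → s < a → Φ s ≤ t) : a ≤ youngInv Φ t := by
  refine le_csInf (hΦ.exists_lt t) ?_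
  rintro r ⟨hr0, hr⟩
  by_contra! hlt
  have hr_pos : 0 < r := by
    refine lt_of_le_of_ne hr0 ?_
    rintro rfl
    rw [hΦ.map_zero] at hr
    linarith
  exact absurd (H r hr_pos hlt) (not_le.2 hr)

/-- The Luxemburg-type condition for the weak Orlicz quasi-norm of a multiple of an indicator. -/
theorem mem_wOrliczSet_indicator_iff {α : Type*} [MeasurableSpace α] {μ : Measure α}
    {Φ : ℝ → ℝ} {A : Set α} {t c b : ℝ} (ht : 0 ≤ t) (hA : μ A = (ENNReal.ofReal t)⁻¹)
    (hc : 0 ≤ c) :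
    b ∈ wOrliczSet μ Φ (A.indicator fun _ => c) ↔
      0 < b ∧ ∀ s, 0 < s → s < c / b → Φ s ≤ t := by
  have key : ∀ s, ENNReal.ofReal (Φ s) * μ A ≤ 1 ↔ Φ s ≤ t := fun s => by
    rw [hA, ← div_eq_mul_inv, ENNReal.div_le_iff_le_mul (by simp) (by simp), one_mul,
      ENNReal.ofReal_le_ofReal_iff ht]
  refine and_congr_right fun hb => forall₂_congr fun s hs => ?_
  by_cases hsc : s < c / b
  · have hset : {x | s < |A.indicator (fun _ => c) x| / b} = A := by
      ext x
      by_cases hx : x ∈ A <;> simp [hx, abs_of_nonneg hc, hsc, hs.le]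
    simp [hset, key, hsc]
  · have hset : {x | s < |A.indicator (fun _ => c) x| / b} = ∅ := by
      ext x
      by_cases hx : x ∈ A
      · simpa [hx, abs_of_nonneg hc] using hsc
      · simp [hx, hs.le]
    simp [hset, hsc]

theorem wOrliczNorm_indicator_youngInv_le_one {α : Type*} [MeasurableSpace α] {μ : Measure α}
    (Φ : ℝ → ℝ) {A : Set α} {t : ℝ} (ht : 0 ≤ t) (hA : μ A = (ENNReal.ofReal t)⁻¹) :
    wOrliczNorm μ Φ (A.indicator fun _ => youngInv Φ t) ≤ 1 := by
  have hmem : (1 : ℝ) ∈ wOrliczSet μ Φ (A.indicator fun _ => youngInv Φ t) := by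
    rw [mem_wOrliczSet_indicator_iff ht hA (youngInv_nonneg Φ t)]
    exact ⟨one_pos, fun s hs hst => apply_le_of_lt_youngInv hs.le (by simpa using hst)⟩
  exact (iInf₂_le 1 hmem).trans_eq ENNReal.ofReal_one

theorem IsYoung.le_mul_youngInv_of_wOrliczNorm_indicator_le {α : Type*} [MeasurableSpace α]
    {μ : Measure α} {Φ : ℝ → ℝ} (hΦ : IsYoung Φ) {A : Set α} {t c M : ℝ} (ht : 0 ≤ t)
    (hA : μ A = (ENNReal.ofReal t)⁻¹) (hc : 0 ≤ c) (hM : 0 ≤ M)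
    (hle : wOrliczNorm μ Φ (A.indicator fun _ => c) ≤ ENNReal.ofReal M) :
    c ≤ M * youngInv Φ t := by
  have step : ∀ b, M < b → c ≤ b * youngInv Φ t := fun b hMb => by
    have hlt : wOrliczNorm μ Φ (A.indicator fun _ => c) < ENNReal.ofReal b :=
      hle.trans_lt ((ENNReal.ofReal_lt_ofReal_iff (hM.trans_lt hMb)).2 hMb)
    simp only [wOrliczNorm, iInf_lt_iff] at hlt
    obtain ⟨d, hd, hdb⟩ := hlt
    obtain ⟨hd0, hd⟩ := (mem_wOrliczSet_indicator_iff ht hA hc).1 hd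
    have hdb' : d < b := (ENNReal.ofReal_lt_ofReal_iff (hM.trans_lt hMb)).1 hdb
    calc c ≤ youngInv Φ t * d := (div_le_iff₀ hd0).1 (hΦ.le_youngInv ht hd)
      _ ≤ youngInv Φ t * b := mul_le_mul_of_nonneg_left hdb'.le (youngInv_nonneg Φ t)
      _ = b * youngInv Φ t := mul_comm _ _
  have hlim : Tendsto (fun b => b * youngInv Φ t) (nhdsWithin M (Set.Ioi M))
      (nhds (M * youngInv Φ t)) :=
    ((continuous_id.mul continuous_const).tendsto M).mono_left nhdsWithin_le_nhds
  exact ge_of_tendsto hlim (eventually_mem_nhdsWithin.mono step)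

theorem EuclideanSpace.exists_measurableSet_volume_eq_inv {n : ℕ} (hn : 0 < n) {t : ℝ}
    (ht : 0 ≤ t) :
    ∃ A : Set (EuclideanSpace ℝ (Fin n)), MeasurableSet A ∧ volume A = (ENNReal.ofReal t)⁻¹ := by
  have : Nonempty (Fin n) := ⟨⟨0, hn⟩⟩
  rcases ht.eq_or_lt with rfl | ht
  · exact ⟨Set.univ, MeasurableSet.univ, by
      simp [measure_univ_of_isAddLeftInvariant]⟩
  · let a : Fin n → ℝ := fun i => if i = ⟨0, hn⟩ then t⁻¹ else 1
    refine ⟨(MeasurableEquiv.toLp 2 (Fin n → ℝ)).symm ⁻¹' Set.Icc 0 a,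
      (MeasurableEquiv.measurable _) measurableSet_Icc, ?_⟩
    have hv := (EuclideanSpace.volume_preserving_symm_measurableEquiv_toLp (Fin n)).measure_preimage
      (s := Set.Icc 0 a) measurableSet_Icc.nullMeasurableSet
    rw [hv, Real.volume_Icc_pi, Finset.prod_eq_single ⟨0, hn⟩]
    · simp [a, ENNReal.ofReal_inv_of_pos ht]
    · intro i _ hi
      simp [a, hi]
    · simp

/-- If the generalized Hölder inequality holds in weak Orlicz spaces with constant `M`,
then `∏ Φᵢ⁻¹(t) ≤ M·Φ⁻¹(t)` for all `t ≥ 0`. -/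
theorem youngInv_prod_le_of_generalized_holder_weak_orlicz {n : ℕ} (hn : 0 < n)
    (m : ℕ) (hm : 2 ≤ m) (Φ : ℝ → ℝ) (Φi : Fin m → ℝ → ℝ)
    (hΦ : IsYoung Φ) (hΦi : ∀ i, IsYoung (Φi i))
    (M : ℝ) (hM : 0 < M)
    (h : ∀ F : Fin m → EuclideanSpace ℝ (Fin n) → ℝ,
      (∀ i, MemwOrlicz (volume : Measure (EuclideanSpace ℝ (Fin n))) (Φi i) (F i)) →
      wOrliczNorm volume Φ (fun x => ∏ i, F i x) ≤
        ENNReal.ofReal M * ∏ i, wOrliczNorm volume (Φi i) (F i)) :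
    ∀ t ≥ 0, (∏ i, youngInv (Φi i) t) ≤ M * youngInv Φ t := by
  intro t ht
  obtain ⟨A, hAm, hA⟩ := EuclideanSpace.exists_measurableSet_volume_eq_inv hn ht
  have : Nonempty (Fin m) := ⟨⟨0, by omega⟩⟩
  have hnorm i := wOrliczNorm_indicator_youngInv_le_one (Φi i) ht hA
  have hH := h (fun i => A.indicator fun _ => youngInv (Φi i) t) fun i =>
    ⟨measurable_const.indicator hAm, (hnorm i).trans_lt ENNReal.one_lt_top⟩
  have hprod : (fun x => ∏ i, A.indicator (fun _ => youngInv (Φi i) t) x) =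
      A.indicator fun _ => ∏ i, youngInv (Φi i) t := by
    ext x
    by_cases hx : x ∈ A <;> simp [hx, Fin.pos_iff_nonempty.2 this |>.ne']
  rw [hprod] at hH
  refine hΦ.le_mul_youngInv_of_wOrliczNorm_indicator_le ht hA
    (Finset.prod_nonneg fun i _ => youngInv_nonneg _ _) hM.le (hH.trans ?_)
  exact mul_le_of_le_one_right' (Finset.prod_le_one' fun i _ => hnorm i)
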